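/- Let N ≥ 3 be an integer, α ≥ 0 a real number, and let i, m be integers with 1 ≤ i ≤ m−1. Assume that for every integer k ≥ 1 the map β ↦ z_k(β), assigning to β > 0 the k-th positive zero of 𝒥_β, is strictly increasing. If β_i > 0 is such that the i-th positive zero of 𝒥_{β_i} equals the m-th positive zero of 𝒥_{(N−2)/(2+α)}, then β_i > (N−2)/(2+α) + 2(m−i). -/

import Mathlib

/-- The Bessel function of the first kind of order `β`,
`𝒥_β(r) = Σ_{k=0}^∞ (−1)^k/(k!·Γ(k+1+β)) · (r/2)^{2k+β}`. -/
noncomputable def besselJ (β r : ℝ) : ℝ :=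
  ∑' k : ℕ, ((-1 : ℝ) ^ k / (Nat.factorial k * Real.Gamma ((k : ℝ) + 1 + β))) *
    (r / 2) ^ (2 * (k : ℝ) + β)

/-- `z` is the `m`-th positive zero of `𝒥_β`: it is a positive zero of `𝒥_β` and
there are exactly `m − 1` zeros of `𝒥_β` in `(0, z)`. -/
def IsNthPosZero (β : ℝ) (m : ℕ) (z : ℝ) : Prop :=
  0 < z ∧ besselJ β z = 0 ∧
    Set.ncard {t : ℝ | t ∈ Set.Ioo 0 z ∧ besselJ β t = 0} = m - 1

noncomputable def bA (β : ℝ) (k : ℕ) : ℝ :=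
  (-1 : ℝ) ^ k / (Nat.factorial k * Real.Gamma ((k : ℝ) + 1 + β))

noncomputable def bF (β x : ℝ) : ℝ := ∑' k : ℕ, bA β k * x ^ k

theorem gamma_lb (β : ℝ) (hβ : 0 ≤ β) (k : ℕ) :
    Real.Gamma (1 + β) * (1 + β) ^ k ≤ Real.Gamma ((k : ℝ) + 1 + β) := by
  induction k with
  | zero => simp
  | succ k ih =>
    have h1 : ((k : ℝ) + 1 + β) ≠ 0 := by positivity
    have e : ((k + 1 : ℕ) : ℝ) + 1 + β = ((k : ℝ) + 1 + β) + 1 := by push_cast; ring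
    rw [e, Real.Gamma_add_one h1, pow_succ]
    have hG : 0 < Real.Gamma (1 + β) := Real.Gamma_pos_of_pos (by linarith)
    have hk : (0 : ℝ) ≤ k := Nat.cast_nonneg k
    calc Real.Gamma (1 + β) * ((1 + β) ^ k * (1 + β))
        = (1 + β) * (Real.Gamma (1 + β) * (1 + β) ^ k) := by ring
      _ ≤ ((k : ℝ) + 1 + β) * Real.Gamma ((k : ℝ) + 1 + β) := by
        apply mul_le_mul _ ih (by positivity) (by positivity)
        linarith

theorem bA_abs (β : ℝ) (hβ : 0 ≤ β) (k : ℕ) :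
    |bA β k| ≤ 1 / Real.Gamma (1 + β) * (1 / (1 + β) ^ k) * (1 / (Nat.factorial k : ℝ)) := by
  have hG : 0 < Real.Gamma (1 + β) := Real.Gamma_pos_of_pos (by linarith)
  have h := gamma_lb β hβ k
  have hp : 0 < Real.Gamma (1 + β) * (1 + β) ^ k := by positivity
  have hf : (0 : ℝ) < Nat.factorial k := by positivity
  have hG' : 0 < Real.Gamma ((k : ℝ) + 1 + β) := lt_of_lt_of_le hp h
  unfold bA
  rw [abs_div, abs_pow, abs_neg, abs_one, one_pow, abs_of_pos (by positivity)]
  rw [div_mul_div_comm, div_mul_div_comm]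
  simp only [one_mul]
  rw [mul_comm (Nat.factorial k : ℝ)]
  gcongr

theorem bA_abs' (β : ℝ) (hβ : 0 ≤ β) (k : ℕ) :
    |bA β k| ≤ 1 / Real.Gamma (1 + β) * (1 / (Nat.factorial k : ℝ)) := by
  have hG : 0 < Real.Gamma (1 + β) := Real.Gamma_pos_of_pos (by linarith)
  refine (bA_abs β hβ k).trans ?_
  have h1 : (1 : ℝ) ≤ (1 + β) ^ k := one_le_pow₀ (by linarith)
  have h2 : 1 / (1 + β) ^ k ≤ 1 := by
    rw [div_le_one (by positivity)]; exact h1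
  gcongr
  calc 1 / Real.Gamma (1 + β) * (1 / (1 + β) ^ k) ≤ 1 / Real.Gamma (1 + β) * 1 := by gcongr
    _ = _ := mul_one _

theorem bF_summable (β : ℝ) (hβ : 0 ≤ β) (x : ℝ) : Summable fun k : ℕ => bA β k * x ^ k := by
  refine Summable.of_norm_bounded
    (g := fun k : ℕ => 1 / Real.Gamma (1 + β) * (|x| ^ k / (Nat.factorial k : ℝ)))
    ((Real.summable_pow_div_factorial |x|).mul_left _) fun k => ?_
  rw [Real.norm_eq_abs, abs_mul, abs_pow]
  calc |bA β k| * |x| ^ k ≤ (1 / Real.Gamma (1 + β) * (1 / (Nat.factorial k : ℝ))) * |x| ^ k := by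
        gcongr; exact bA_abs' β hβ k
    _ = _ := by ring

theorem bA_succ (β : ℝ) (k : ℕ) : bA β (k + 1) * ((k : ℝ) + 1) = - bA (β + 1) k := by
  unfold bA
  have e : ((k + 1 : ℕ) : ℝ) + 1 + β = (k : ℝ) + 1 + (β + 1) := by push_cast; ring
  rw [e, Nat.factorial_succ]
  push_cast
  have hf : (Nat.factorial k : ℝ) ≠ 0 := by positivity
  have hk : (k : ℝ) + 1 ≠ 0 := by positivity
  by_cases h : Real.Gamma ((k : ℝ) + 1 + (β + 1)) = 0
  · simp [h]
  · field_simp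
    ring

theorem bA_rec_zero (β : ℝ) (hβ : 0 ≤ β) : bA β 0 = (β + 1) * bA (β + 1) 0 := by
  have hG : 0 < Real.Gamma (1 + β) := Real.Gamma_pos_of_pos (by linarith)
  unfold bA
  have e : ((0 : ℕ) : ℝ) + 1 + (β + 1) = (1 + β) + 1 := by push_cast; ring
  rw [e, Real.Gamma_add_one (by positivity)]
  have : β + 1 ≠ 0 := by positivity
  have : 1 + β ≠ 0 := by positivity
  simp
  field_simp
  ring

theorem bA_rec_succ (β : ℝ) (hβ : 0 ≤ β) (k : ℕ) :
    bA β (k + 1) = (β + 1) * bA (β + 1) (k + 1) - bA (β + 2) k := by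
  have hG : 0 < Real.Gamma ((k : ℝ) + 2 + β) := Real.Gamma_pos_of_pos (by positivity)
  unfold bA
  have e1 : ((k + 1 : ℕ) : ℝ) + 1 + β = (k : ℝ) + 2 + β := by push_cast; ring
  have e2 : ((k + 1 : ℕ) : ℝ) + 1 + (β + 1) = ((k : ℝ) + 2 + β) + 1 := by push_cast; ring
  have e3 : (k : ℝ) + 1 + (β + 2) = ((k : ℝ) + 2 + β) + 1 := by ring
  rw [e1, e2, e3, Real.Gamma_add_one (by positivity), Nat.factorial_succ]
  push_cast
  have hf : (Nat.factorial k : ℝ) ≠ 0 := by positivity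
  have hk : (k : ℝ) + 1 ≠ 0 := by positivity
  have hk : (k : ℝ) + 2 + β ≠ 0 := by positivity
  field_simp
  ring

theorem bF_rec (β : ℝ) (hβ : 0 ≤ β) (x : ℝ) :
    bF β x = (β + 1) * bF (β + 1) x - x * bF (β + 2) x := by
  unfold bF
  have s0 := bF_summable β hβ x
  have s1 := bF_summable (β + 1) (by linarith) x
  have s2 := bF_summable (β + 2) (by linarith) x
  rw [s0.tsum_eq_zero_add, s1.tsum_eq_zero_add, mul_add, ← tsum_mul_left, ← tsum_mul_left,
    add_sub_assoc, ← Summable.tsum_sub]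
  · congr 1
    · rw [bA_rec_zero β hβ]; ring
    · congr 1
      funext k
      rw [bA_rec_succ β hβ]; ring
  · exact ((summable_nat_add_iff 1).2 s1).mul_left _
  · exact s2.mul_left _

theorem bF_hasDerivAt (β : ℝ) (hβ : 0 ≤ β) (x : ℝ) :
    HasDerivAt (bF β) (- bF (β + 1) x) x := by
  have hG : 0 < Real.Gamma (1 + β) := Real.Gamma_pos_of_pos (by linarith)
  set R : ℝ := |x| + 1
  have hR : 0 < R := by positivity
  have hu : Summable fun k : ℕ => 1 / Real.Gamma (1 + β) * (k * R ^ (k - 1) / (Nat.factorial k : ℝ)) := by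
    apply Summable.mul_left
    rw [← summable_nat_add_iff 1]
    refine (Real.summable_pow_div_factorial R).congr fun k => ?_
    rw [Nat.factorial_succ]
    push_cast
    have hf : (Nat.factorial k : ℝ) ≠ 0 := by positivity
    have hk : (k : ℝ) + 1 ≠ 0 := by positivity
    field_simp
  have h := hasDerivAt_tsum_of_isPreconnected (𝕜 := ℝ) (F := ℝ) hu (t := Metric.ball (0 : ℝ) R)
    (g := fun k y => bA β k * y ^ k) (g' := fun k y => bA β k * (k * y ^ (k - 1)))
    (y₀ := 0) (y := x) Metric.isOpen_ball (convex_ball _ _).isPreconnected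
    (fun k y _ => (hasDerivAt_pow k y).const_mul _) ?_ (Metric.mem_ball_self hR)
    (bF_summable β hβ 0) (by simp [R])
  · have hs : Summable fun k : ℕ => bA β k * (k * x ^ (k - 1)) := by
      rw [← summable_nat_add_iff 1]
      refine (bF_summable (β + 1) (by linarith) x).neg.congr fun k => ?_
      simp only [Nat.add_sub_cancel]
      push_cast
      rw [← mul_assoc, bA_succ]; ring
    have : ∑' k : ℕ, bA β k * (k * x ^ (k - 1)) = - bF (β + 1) x := by
      rw [hs.tsum_eq_zero_add]
      unfold bF
      rw [← tsum_neg]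
      simp only [Nat.cast_zero, zero_mul, mul_zero, zero_add]
      congr 1
      funext k
      simp only [Nat.add_sub_cancel]
      push_cast
      rw [← mul_assoc, bA_succ]; ring
    rw [this] at h
    exact h
  · intro k y hy
    rw [mem_ball_zero_iff, Real.norm_eq_abs] at hy
    rw [Real.norm_eq_abs, abs_mul, abs_mul, abs_pow, Nat.abs_cast]
    calc |bA β k| * (k * |y| ^ (k - 1))
        ≤ (1 / Real.Gamma (1 + β) * (1 / (Nat.factorial k : ℝ))) * (k * R ^ (k - 1)) := by
          gcongr
          exact bA_abs' β hβ k
      _ = _ := by ring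

theorem bF_ne_zero_of_large (β : ℝ) (hβ : 0 ≤ β) (x : ℝ) (hx : 0 ≤ x) (h : 2 * x < 1 + β) :
    bF β x ≠ 0 := by
  have hG : 0 < Real.Gamma (1 + β) := Real.Gamma_pos_of_pos (by linarith)
  set q := x / (1 + β) with hq
  have hb : 0 < 1 + β := by positivity
  have hq0 : 0 ≤ q := by positivity
  have hq1 : q < 1 / 2 := by rw [hq, div_lt_iff₀ hb]; linarith
  have s := bF_summable β hβ x
  unfold bF
  rw [s.tsum_eq_zero_add]
  have hgeo : HasSum (fun k : ℕ => 1 / Real.Gamma (1 + β) * q * q ^ k)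
      (1 / Real.Gamma (1 + β) * q * (1 - q)⁻¹) :=
    (hasSum_geometric_of_lt_one hq0 (by linarith)).mul_left _
  have hle := tsum_of_norm_bounded (f := fun k : ℕ => bA β (k + 1) * x ^ (k + 1)) hgeo ?_
  · have h0 : bA β 0 * x ^ 0 = 1 / Real.Gamma (1 + β) := by simp [bA]
    rw [h0]
    intro h1
    have h2 : ∑' k : ℕ, bA β (k + 1) * x ^ (k + 1) = - (1 / Real.Gamma (1 + β)) := by linarith
    rw [h2, norm_neg, Real.norm_eq_abs, abs_of_pos (by positivity), mul_assoc] at hle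
    have h3 : q * (1 - q)⁻¹ < 1 := by
      rw [← div_eq_mul_inv, div_lt_one (by linarith)]; linarith
    have : 1 / Real.Gamma (1 + β) * (q * (1 - q)⁻¹) < 1 / Real.Gamma (1 + β) * 1 := by
      gcongr
    linarith
  · intro k
    rw [Real.norm_eq_abs, abs_mul, abs_pow, abs_of_nonneg hx]
    have hf : (1 : ℝ) ≤ Nat.factorial (k + 1) := by
      exact_mod_cast Nat.one_le_iff_ne_zero.2 (Nat.factorial_ne_zero _)
    have hf' : 1 / (Nat.factorial (k + 1) : ℝ) ≤ 1 := by
      rw [div_le_one (by positivity)]; exact hf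
    calc |bA β (k + 1)| * x ^ (k + 1)
        ≤ (1 / Real.Gamma (1 + β) * (1 / (1 + β) ^ (k + 1)) * 1) * x ^ (k + 1) := by
          gcongr
          refine (bA_abs β hβ (k + 1)).trans ?_
          gcongr
      _ = 1 / Real.Gamma (1 + β) * q ^ (k + 1) := by rw [hq, div_pow]; ring
      _ = _ := by rw [pow_succ]; ring

theorem bF_zero_ne (β : ℝ) (hβ : 0 ≤ β) : bF β 0 ≠ 0 :=
  bF_ne_zero_of_large β hβ 0 le_rfl (by linarith)

theorem bF_simple (β : ℝ) (hβ : 0 ≤ β) (x : ℝ) (hx : 0 < x) (h : bF β x = 0) :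
    bF (β + 1) x ≠ 0 := by
  intro h1
  have key : ∀ n : ℕ, bF (β + n) x = 0 ∧ bF (β + n + 1) x = 0 := by
    intro n
    induction n with
    | zero => simpa using ⟨h, h1⟩
    | succ n ih =>
      have hr := bF_rec (β + n) (by positivity) x
      rw [ih.1, ih.2] at hr
      have h2 : bF (β + n + 2) x = 0 := by
        have : x * bF (β + n + 2) x = 0 := by linarith
        rcases mul_eq_zero.1 this with h | h
        · exact absurd h hx.ne'
        · exact h
      push_cast
      refine ⟨by rw [← add_assoc]; exact ih.2, ?_⟩
      convert h2 using 2
      ring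
  obtain ⟨n, hn⟩ := exists_nat_gt (2 * x)
  exact bF_ne_zero_of_large (β + n) (by positivity) x hx.le (by linarith) (key n).1

theorem bF_cont (β : ℝ) (hβ : 0 ≤ β) : Continuous (bF β) :=
  continuous_iff_continuousAt.2 fun x => (bF_hasDerivAt β hβ x).continuousAt

/-- Sign of the derivative at the ends of an interval of positivity. -/
theorem end_signs (f : ℝ → ℝ) (a b da db : ℝ) (hab : a < b) (ha : f a = 0) (hb : f b = 0)
    (hda : HasDerivAt f da a) (hdb : HasDerivAt f db b)
    (hpos : ∀ x ∈ Set.Ioo a b, 0 < f x) : 0 ≤ da ∧ db ≤ 0 := by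
  constructor
  · have h := (hasDerivAt_iff_tendsto_slope.1 hda).mono_left
      (nhdsWithin_mono a (fun x (hx : x ∈ Set.Ioi a) => ne_of_gt hx))
    refine ge_of_tendsto h ?_
    filter_upwards [Ioo_mem_nhdsGT hab] with x hx
    rw [slope_def_field, ha, sub_zero]
    exact div_nonneg (hpos x hx).le (by linarith [hx.1])
  · have h := (hasDerivAt_iff_tendsto_slope.1 hdb).mono_left
      (nhdsWithin_mono b (fun x (hx : x ∈ Set.Iio b) => ne_of_lt hx))
    refine le_of_tendsto h ?_
    filter_upwards [Ioo_mem_nhdsLT hab] with x hx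
    rw [slope_def_field, hb, sub_zero]
    exact div_nonpos_of_nonneg_of_nonpos (hpos x hx).le (by linarith [hx.2])

theorem bF_between (β : ℝ) (hβ : 0 ≤ β) (a b : ℝ) (ha0 : 0 < a) (hab : a < b)
    (ha : bF β a = 0) (hb : bF β b = 0) (hne : ∀ x ∈ Set.Ioo a b, bF β x ≠ 0) :
    ∃ c ∈ Set.Ioo a b, bF (β + 2) c = 0 := by
  have hb0 : 0 < b := ha0.trans hab
  have sa := bF_simple β hβ a ha0 ha
  have sb := bF_simple β hβ b hb0 hb
  have ra := bF_rec β hβ a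
  have rb := bF_rec β hβ b
  rw [ha] at ra
  rw [hb] at rb
  have da := bF_hasDerivAt β hβ a
  have db := bF_hasDerivAt β hβ b
  have c2 := (bF_cont (β + 2) (by linarith)).continuousOn (s := Set.Icc a b)
  have ea : bF (β + 2) a = (β + 1) / a * bF (β + 1) a := by field_simp; linarith
  have eb : bF (β + 2) b = (β + 1) / b * bF (β + 1) b := by field_simp; linarith
  have pa : 0 < (β + 1) / a := by positivity
  have pb : 0 < (β + 1) / b := by positivity
  have hsign : (∀ x ∈ Set.Ioo a b, 0 < bF β x) ∨ (∀ x ∈ Set.Ioo a b, bF β x < 0) := by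
    by_contra hcon
    push Not at hcon
    obtain ⟨⟨x, hx, hx'⟩, y, hy, hy'⟩ := hcon
    obtain ⟨c, hc, hc'⟩ := isPreconnected_Ioo.intermediate_value hx hy
      ((bF_cont β hβ).continuousOn) (Set.mem_Icc.2 ⟨hx', hy'⟩)
    exact hne c hc hc'
  rcases hsign with hs | hs
  · obtain ⟨h1, h2⟩ := end_signs _ a b _ _ hab ha hb da db hs
    have h1' : bF (β + 1) a < 0 := lt_of_le_of_ne (by linarith) sa
    have h2' : 0 < bF (β + 1) b := lt_of_le_of_ne (by linarith) (Ne.symm sb)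
    have := intermediate_value_Ioo hab.le c2
    obtain ⟨c, hc, hc'⟩ := this (show (0 : ℝ) ∈ Set.Ioo _ _ from
      ⟨by rw [ea]; exact mul_neg_of_pos_of_neg pa h1', by rw [eb]; exact mul_pos pb h2'⟩)
    exact ⟨c, hc, hc'⟩
  · obtain ⟨h1, h2⟩ := end_signs (fun x => - bF β x) a b _ _ hab (by simp [ha]) (by simp [hb])
      da.fun_neg db.fun_neg (fun x hx => by simpa using hs x hx)
    have h1' : 0 < bF (β + 1) a := lt_of_le_of_ne (by linarith) (Ne.symm sa)
    have h2' : bF (β + 1) b < 0 := lt_of_le_of_ne (by linarith) sb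
    have := intermediate_value_Ioo' hab.le c2
    obtain ⟨c, hc, hc'⟩ := this (show (0 : ℝ) ∈ Set.Ioo _ _ from
      ⟨by rw [eb]; exact mul_neg_of_pos_of_neg pb h2', by rw [ea]; exact mul_pos pa h1'⟩)
    exact ⟨c, hc, hc'⟩

theorem bF_finite (β : ℝ) (hβ : 0 ≤ β) (W : ℝ) :
    {x : ℝ | x ∈ Set.Icc 0 W ∧ bF β x = 0}.Finite := by
  by_contra hinf
  obtain ⟨x, hx, hacc⟩ := Set.Infinite.exists_accPt_of_subset_isCompact (K := Set.Icc 0 W)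
    hinf isCompact_Icc (fun x hx => hx.1)
  rw [accPt_iff_frequently_nhdsNE] at hacc
  have hfx : bF β x = 0 := by
    by_contra hne
    have := (bF_cont β hβ).continuousAt.eventually_ne hne
    exact hacc ((this.filter_mono nhdsWithin_le_nhds).mono fun y hy h => hy h.2)
  have hx0 : 0 < x := by
    refine lt_of_le_of_ne hx.1 fun h => ?_
    rw [← h] at hfx
    exact bF_zero_ne β hβ hfx
  have hd := (bF_hasDerivAt β hβ x).eventually_ne (c := 0)
    (neg_ne_zero.2 (bF_simple β hβ x hx0 hfx))
  exact hacc (hd.mono fun y hy h => hy h.2)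

theorem besselJ_eq (β r : ℝ) (hr : 0 < r) : besselJ β r = (r / 2) ^ β * bF β ((r / 2) ^ 2) := by
  unfold besselJ bF
  rw [← tsum_mul_left]
  congr 1
  funext k
  rw [Real.rpow_add (by positivity), ← pow_mul]
  have : (r / 2) ^ (2 * (k : ℝ)) = (r / 2) ^ (2 * k) := by
    rw [← Real.rpow_natCast]; push_cast; rfl
  rw [this]
  unfold bA
  ring

theorem besselJ_zero_iff (β r : ℝ) (hr : 0 < r) : besselJ β r = 0 ↔ bF β ((r / 2) ^ 2) = 0 := by
  rw [besselJ_eq β r hr, mul_eq_zero]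
  have : (r / 2) ^ β ≠ 0 := (Real.rpow_pos_of_pos (by positivity) β).ne'
  simp [this]

theorem besselJ_finite (β : ℝ) (hβ : 0 ≤ β) (w : ℝ) :
    {t : ℝ | t ∈ Set.Ioc 0 w ∧ besselJ β t = 0}.Finite := by
  refine Set.Finite.of_finite_image (f := fun t : ℝ => (t / 2) ^ 2)
    ((bF_finite β hβ ((w / 2) ^ 2)).subset ?_) ?_
  · rintro _ ⟨t, ⟨ht, h0⟩, rfl⟩
    have := ht.1
    have := ht.2
    refine ⟨⟨by positivity, ?_⟩, (besselJ_zero_iff β t ht.1).1 h0⟩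
    dsimp only
    gcongr
  · intro s hs t ht h
    have h1 := hs.1.1
    have h2 := ht.1.1
    have := (pow_left_inj₀ (by positivity) (by positivity) two_ne_zero).1 h
    linarith

theorem besselJ_between (β : ℝ) (hβ : 0 ≤ β) (a b : ℝ) (ha0 : 0 < a) (hab : a < b)
    (ha : besselJ β a = 0) (hb : besselJ β b = 0) (hne : ∀ x ∈ Set.Ioo a b, besselJ β x ≠ 0) :
    ∃ c ∈ Set.Ioo a b, besselJ (β + 2) c = 0 := by
  have hb0 : 0 < b := ha0.trans hab
  have aux : ∀ c ∈ Set.Ioo ((a / 2) ^ 2) ((b / 2) ^ 2), ∃ r ∈ Set.Ioo a b, (r / 2) ^ 2 = c := by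
    intro c hc
    have hc0 : 0 < c := lt_trans (by positivity) hc.1
    refine ⟨2 * √c, ⟨?_, ?_⟩, ?_⟩
    · have := (Real.lt_sqrt (by positivity)).2 hc.1
      linarith
    · have := (Real.sqrt_lt' (by positivity)).2 hc.2
      linarith
    · rw [mul_div_cancel_left₀ _ two_ne_zero, Real.sq_sqrt hc0.le]
  obtain ⟨c, hc, hc'⟩ := bF_between β hβ ((a / 2) ^ 2) ((b / 2) ^ 2) (by positivity)
    (by gcongr) ((besselJ_zero_iff β a ha0).1 ha) ((besselJ_zero_iff β b hb0).1 hb) (by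
      intro x hx h
      obtain ⟨r, hr, rfl⟩ := aux x hx
      exact hne r hr ((besselJ_zero_iff β r (ha0.trans hr.1)).2 h))
  obtain ⟨r, hr, rfl⟩ := aux c hc
  exact ⟨r, hr, (besselJ_zero_iff _ r (ha0.trans hr.1)).2 hc'⟩

theorem open_finite (β : ℝ) (hβ : 0 ≤ β) (w : ℝ) :
    {t : ℝ | t ∈ Set.Ioo 0 w ∧ besselJ β t = 0}.Finite :=
  (besselJ_finite β hβ w).subset fun _ ht => ⟨⟨ht.1.1, ht.1.2.le⟩, ht.2⟩

theorem count_step (β : ℝ) (hβ : 0 ≤ β) (w : ℝ) :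
    Set.ncard {t : ℝ | t ∈ Set.Ioc 0 w ∧ besselJ β t = 0} ≤
      Set.ncard {t : ℝ | t ∈ Set.Ioo 0 w ∧ besselJ (β + 2) t = 0} + 1 := by
  have f1 := besselJ_finite β hβ w
  have f2 := open_finite (β + 2) (by linarith) w
  rw [Set.ncard_eq_toFinset_card _ f1, Set.ncard_eq_toFinset_card _ f2]
  apply Finset.card_le_of_interleaved
  intro x hx y hy hxy hz
  simp only [Set.Finite.mem_toFinset, Set.mem_setOf_eq] at hx hy hz ⊢
  obtain ⟨c, hc, hc'⟩ := besselJ_between β hβ x y hx.1.1 hxy hx.2 hy.2 (by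
    intro u hu h
    exact hz u ⟨⟨hx.1.1.trans hu.1, hu.2.le.trans hy.1.2⟩, h⟩ hu)
  exact ⟨c, ⟨⟨hx.1.1.trans hc.1, hc.2.trans_le hy.1.2⟩, hc'⟩, hc.1, hc.2⟩

theorem count_iter (β : ℝ) (hβ : 0 ≤ β) (w : ℝ) (n : ℕ) :
    Set.ncard {t : ℝ | t ∈ Set.Ioc 0 w ∧ besselJ β t = 0} ≤
      Set.ncard {t : ℝ | t ∈ Set.Ioo 0 w ∧ besselJ (β + 2 * ((n : ℝ) + 1)) t = 0} + (n + 1) := by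
  induction n with
  | zero => simpa using count_step β hβ w
  | succ n ih =>
    have h := count_step (β + 2 * ((n : ℝ) + 1)) (by positivity) w
    have h2 : Set.ncard {t : ℝ | t ∈ Set.Ioo 0 w ∧ besselJ (β + 2 * ((n : ℝ) + 1)) t = 0} ≤
        Set.ncard {t : ℝ | t ∈ Set.Ioc 0 w ∧ besselJ (β + 2 * ((n : ℝ) + 1)) t = 0} :=
      Set.ncard_le_ncard (fun _ ht => ⟨⟨ht.1.1, ht.1.2.le⟩, ht.2⟩)
        (besselJ_finite _ (by positivity) w)
    have e : β + 2 * (((n + 1 : ℕ) : ℝ) + 1) = β + 2 * ((n : ℝ) + 1) + 2 := by push_cast; ring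
    rw [e]
    omega

theorem exists_nth (i : ℕ) (hi : 1 ≤ i) : ∀ (n : ℕ) (s : Finset ℝ), s.card = i + n →
    ∃ z ∈ s, (s.filter (· < z)).card = i - 1 := by
  intro n
  induction n with
  | zero =>
    intro s hs
    have hne : s.Nonempty := Finset.card_pos.1 (by omega)
    refine ⟨s.max' hne, s.max'_mem hne, ?_⟩
    have : s.filter (· < s.max' hne) = s.erase (s.max' hne) := by
      ext x
      simp only [Finset.mem_filter, Finset.mem_erase]
      constructor
      · rintro ⟨h1, h2⟩; exact ⟨h2.ne, h1⟩
      · rintro ⟨h1, h2⟩; exact ⟨h2, lt_of_le_of_ne (s.le_max' x h2) h1⟩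
    rw [this, Finset.card_erase_of_mem (s.max'_mem hne)]
    omega
  | succ n ih =>
    intro s hs
    have hne : s.Nonempty := Finset.card_pos.1 (by omega)
    obtain ⟨z, hz, hz'⟩ := ih (s.erase (s.max' hne))
      (by rw [Finset.card_erase_of_mem (s.max'_mem hne)]; omega)
    rw [Finset.mem_erase] at hz
    refine ⟨z, hz.2, ?_⟩
    rw [← hz']
    congr 1
    ext x
    simp only [Finset.mem_filter, Finset.mem_erase]
    constructor
    · rintro ⟨h1, h2⟩
      exact ⟨⟨(h2.trans_le (s.le_max' z hz.2)).ne, h1⟩, h2⟩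
    · rintro ⟨h1, h2⟩; exact ⟨h1.2, h2⟩

/-- Let `N ≥ 3`, `α ≥ 0` and `1 ≤ i ≤ m−1`. Assuming that for every `k ≥ 1` the map
`β ↦ z_k(β)` (the `k`-th positive Bessel zero) is strictly increasing in `β > 0`,
if `β_i > 0` is such that the `i`-th positive zero of `𝒥_{β_i}` equals the `m`-th positive
zero of `𝒥_{(N−2)/(2+α)}`, then `β_i > (N−2)/(2+α) + 2(m−i)`. -/
theorem beta_i_lower_bound (N : ℕ) (hN : 3 ≤ N) (α : ℝ) (hα : 0 ≤ α)
    (i m : ℕ) (hi : 1 ≤ i) (him : i < m)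
    (hmono : ∀ k : ℕ, 1 ≤ k → ∀ β β' z z' : ℝ, 0 < β → β < β' →
      IsNthPosZero β k z → IsNthPosZero β' k z' → z < z')
    (βi : ℝ) (hβi : 0 < βi) (w : ℝ)
    (hw1 : IsNthPosZero βi i w)
    (hw2 : IsNthPosZero (((N : ℝ) - 2) / (2 + α)) m w) :
    βi > ((N : ℝ) - 2) / (2 + α) + 2 * ((m : ℝ) - (i : ℝ)) := by
  have hN' : (3 : ℝ) ≤ N := by exact_mod_cast hN
  have hβ0 : 0 ≤ ((N : ℝ) - 2) / (2 + α) := div_nonneg (by linarith) (by linarith)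
  generalize ((N : ℝ) - 2) / (2 + α) = β at *
  obtain ⟨n, rfl⟩ : ∃ n, m = i + (n + 1) := ⟨m - i - 1, by omega⟩
  obtain ⟨hw0, hwz, hwc⟩ := hw2
  have e : β + 2 * (((i + (n + 1) : ℕ) : ℝ) - (i : ℝ)) = β + 2 * ((n : ℝ) + 1) := by
    push_cast; ring
  rw [e]
  have hclosed : Set.ncard {t : ℝ | t ∈ Set.Ioc 0 w ∧ besselJ β t = 0} = i + (n + 1) := by
    have : {t : ℝ | t ∈ Set.Ioc 0 w ∧ besselJ β t = 0} =
        insert w {t : ℝ | t ∈ Set.Ioo 0 w ∧ besselJ β t = 0} := by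
      ext t
      simp only [Set.mem_setOf_eq, Set.mem_insert_iff, Set.mem_Ioc, Set.mem_Ioo]
      constructor
      · rintro ⟨⟨h1, h2⟩, h3⟩
        rcases h2.eq_or_lt with h | h
        · exact Or.inl h
        · exact Or.inr ⟨⟨h1, h⟩, h3⟩
      · rintro (rfl | ⟨⟨h1, h2⟩, h3⟩)
        · exact ⟨⟨hw0, le_rfl⟩, hwz⟩
        · exact ⟨⟨h1, h2.le⟩, h3⟩
    rw [this, Set.ncard_insert_of_notMem (by simp) (open_finite β hβ0 w), hwc]
    omega
  have hcount := count_iter β hβ0 w n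
  rw [hclosed] at hcount
  set γ := β + 2 * ((n : ℝ) + 1) with hγ
  have hγ0 : 0 ≤ γ := by positivity
  by_contra hcon
  rcases (not_lt.1 hcon).eq_or_lt with h | h
  · have := hw1.2.2
    rw [h] at this
    omega
  · have hfin := open_finite γ hγ0 w
    rw [Set.ncard_eq_toFinset_card _ hfin] at hcount
    obtain ⟨z, hz, hzc⟩ := exists_nth i hi (hfin.toFinset.card - i) hfin.toFinset (by omega)
    rw [Set.Finite.mem_toFinset] at hz
    have hzN : IsNthPosZero γ i z := by
      refine ⟨hz.1.1, hz.2, ?_⟩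
      rw [← hzc, ← Set.ncard_coe_finset]
      congr 1
      ext t
      simp only [Set.mem_setOf_eq, Finset.coe_filter, Set.Finite.mem_toFinset, Set.mem_Ioo]
      constructor
      · rintro ⟨⟨h1, h2⟩, h3⟩
        exact ⟨⟨⟨h1, h2.trans hz.1.2⟩, h3⟩, h2⟩
      · rintro ⟨⟨⟨h1, h2⟩, h3⟩, h4⟩
        exact ⟨⟨h1, h4⟩, h3⟩
    have := hmono i hi βi γ w z hβi h hw1 hzN
    exact lt_asymm this hz.1.2
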